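/- arXiv:2504.20927 — 5 statements merged into one kernel-verified Lean document; each statement's English description precedes it below -/
import Mathlib

section
/- Lemma 5(b) (graphical condition for strictly better indirect decomposition): For every agent i ∈ V and every j ∈ I^i_GD, the set I^j_Q is a proper subset of I^i_Q̂ if and only if there exist k ∈ V with k ∉ I^j_Q, m ∈ R^i_{(SO)ᵀ}, p ∈ R^k_{(SO)ᵀ}, and h ∈ I^i_GD such that h ∈ I^m_{Cᵀ} ∩ I^p_{Cᵀ}. -/
/-- Backward reachability set of `i` in `E_SO = E_S ∪ E_O`: all `j` with `j →* i`. -/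
def RSO {V : Type*} (ES EO : Set (V × V)) (i : V) : Set V :=
  {j | Relation.ReflTransGen (fun a b => (a, b) ∈ ES ∪ EO) j i}

/-- Forward reachability set of `i` in `E_SO`: all `j` with `i →* j`. -/
def RSOT {V : Type*} (ES EO : Set (V × V)) (i : V) : Set V :=
  {j | Relation.ReflTransGen (fun a b => (a, b) ∈ ES ∪ EO) i j}

/-- The cost in-neighbor set `I^i_C = {k : (k,i) ∈ E_C}`. -/
def IC {V : Type*} (EC : Set (V × V)) (i : V) : Set V := {k | (k, i) ∈ EC}

/-- The cost out-neighbor set `I^i_{Cᵀ} = {j : (i,j) ∈ E_C}`. -/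
def ICt {V : Type*} (EC : Set (V × V)) (i : V) : Set V := {j | (i, j) ∈ EC}

/-- The value dependence set `I^i_Q = ⋃_{k ∈ I^i_C} R^k_SO`. -/
def IQ {V : Type*} (ES EO EC : Set (V × V)) (i : V) : Set V :=
  ⋃ k ∈ IC EC i, RSO ES EO k

/-- The gradient dependency set `I^i_GD = {j : i ∈ I^j_Q}`. -/
def IGD {V : Type*} (ES EO EC : Set (V × V)) (i : V) : Set V :=
  {j | i ∈ IQ ES EO EC j}

/-- The direct value dependence set `I^i_Q̂ = ⋃_{j ∈ I^i_GD} I^j_Q`. -/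
def IQhat {V : Type*} (ES EO EC : Set (V × V)) (i : V) : Set V :=
  ⋃ j ∈ IGD ES EO EC i, IQ ES EO EC j

/-- Lemma 5(b): for every `i` and every `j ∈ I^i_GD`, `I^j_Q ⊂ I^i_Q̂` iff there exist
`k ∉ I^j_Q`, `m ∈ R^i_{(SO)ᵀ}`, `p ∈ R^k_{(SO)ᵀ}`, and `h ∈ I^i_GD` with
`h ∈ I^m_{Cᵀ} ∩ I^p_{Cᵀ}`. -/
theorem IQ_proper_subset_IQhat_iff {V : Type*} [Fintype V] (ES EO EC : Set (V × V)) :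
    ∀ i : V, ∀ j ∈ IGD ES EO EC i,
      IQ ES EO EC j ⊂ IQhat ES EO EC i ↔
        ∃ k : V, k ∉ IQ ES EO EC j ∧
          ∃ m ∈ RSOT ES EO i, ∃ p ∈ RSOT ES EO k, ∃ h ∈ IGD ES EO EC i,
            h ∈ ICt EC m ∩ ICt EC p := by
  intro i j hj
  have key : ∀ k h, k ∈ IQ ES EO EC h ↔ ∃ p ∈ RSOT ES EO k, h ∈ ICt EC p := by
    intro k h
    simp only [IQ, IC, RSO, RSOT, ICt, Set.mem_iUnion, Set.mem_setOf_eq, exists_prop]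
    exact ⟨fun ⟨p, a, b⟩ => ⟨p, b, a⟩, fun ⟨p, a, b⟩ => ⟨p, b, a⟩⟩
  constructor
  · intro hs
    obtain ⟨k, hk, hkj⟩ := Set.exists_of_ssubset hs
    simp only [IQhat, Set.mem_iUnion, exists_prop] at hk
    obtain ⟨h, hh, hkh⟩ := hk
    obtain ⟨p, hp, hph⟩ := (key k h).1 hkh
    obtain ⟨m, hm, hmh⟩ := (key i h).1 hh
    exact ⟨k, hkj, m, hm, p, hp, h, hh, hmh, hph⟩
  · rintro ⟨k, hkj, m, hm, p, hp, h, hh, hmh, hph⟩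
    refine (Set.ssubset_iff_of_subset ?_).2 ⟨k, ?_, hkj⟩
    · intro x hx
      simp only [IQhat, Set.mem_iUnion, exists_prop]
      exact ⟨j, hj, hx⟩
    · simp only [IQhat, Set.mem_iUnion, exists_prop]
      exact ⟨h, hh, (key k h).2 ⟨p, hp, hph⟩⟩
end

section
/- Theorem 1, deterministic trajectory form (value decomposition): Consider the noiseless closed-loop multi-agent system defined by x(1) = A.mulVec x(0) + B.mulVec u(0), u(t) = K.mulVec x(t) for t ≥ 1, and x(t+1) = A.mulVec x(t) + B.mulVec u(t) for t ≥ 1, where A, B, K satisfy the coupling sparsity patterns: A((j,a),(k,b)) = 0 and B((j,a),(k,b)) = 0 whenever (k,j) ∉ E_S, and K((j,a),(k,b)) = 0 whenever (k,j) ∉ E_O. Fix i ∈ V. If two initial pairs (x(0), u(0)) and (y(0), v(0)) agree on the value dependence set, i.e. x(0)(j,a) = y(0)(j,a) and u(0)(j,a) = v(0)(j,a) for all j ∈ I^i_Q and all a, then the resulting trajectories satisfy, for all t ≥ 0, all j ∈ I^i_Q and all a: x(t)(j,a) = y(t)(j,a) and u(t)(j,a) = v(t)(j,a). In particular, since I^i_C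 ⊆ I^i_Q, every stage cost of agent i, being a function of {(x(t)(j,·), u(t)(j,·)) : j ∈ I^i_C}, coincides along the two trajectories for every t; hence the (finite-horizon, noiseless) Q-function of agent i depends only on the states and controls of the agents in I^i_Q. -/
/-- Theorem 1 (value decomposition), deterministic trajectory form: for the noiseless
closed-loop multi-agent dynamics with coupling-sparse `A`, `B`, `K`, two trajectories whose
initial state-control pairs agree on the value dependence set `I^i_Q` agree on `I^i_Q`
(states and controls) for all times; hence the local Q-function of agent `i` depends only
on the states and controls of the agents in `I^i_Q`. -/
theorem value_decomposition_trajectories {V : Type*} [Fintype V] [DecidableEq V]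
    (ES EO EC : Set (V × V)) (nx nu : ℕ)
    (A : Matrix (V × Fin nx) (V × Fin nx) ℝ)
    (B : Matrix (V × Fin nx) (V × Fin nu) ℝ)
    (K : Matrix (V × Fin nu) (V × Fin nx) ℝ)
    (hA : ∀ (j k : V) (a b : Fin nx), (k, j) ∉ ES → A (j, a) (k, b) = 0)
    (hB : ∀ (j k : V) (a : Fin nx) (b : Fin nu), (k, j) ∉ ES → B (j, a) (k, b) = 0)
    (hK : ∀ (j k : V) (a : Fin nu) (b : Fin nx), (k, j) ∉ EO → K (j, a) (k, b) = 0)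
    (i : V)
    (x y : ℕ → V × Fin nx → ℝ) (u v : ℕ → V × Fin nu → ℝ)
    -- dynamics of trajectory (x, u)
    (hx1 : x 1 = A.mulVec (x 0) + B.mulVec (u 0))
    (hu : ∀ t : ℕ, 1 ≤ t → u t = K.mulVec (x t))
    (hx : ∀ t : ℕ, 1 ≤ t → x (t + 1) = A.mulVec (x t) + B.mulVec (u t))
    -- dynamics of trajectory (y, v)
    (hy1 : y 1 = A.mulVec (y 0) + B.mulVec (v 0))
    (hv : ∀ t : ℕ, 1 ≤ t → v t = K.mulVec (y t))
    (hy : ∀ t : ℕ, 1 ≤ t → y (t + 1) = A.mulVec (y t) + B.mulVec (v t))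
    -- initial agreement on the value dependence set
    (h0x : ∀ j ∈ IQ ES EO EC i, ∀ a : Fin nx, x 0 (j, a) = y 0 (j, a))
    (h0u : ∀ j ∈ IQ ES EO EC i, ∀ a : Fin nu, u 0 (j, a) = v 0 (j, a)) :
    ∀ t : ℕ, ∀ j ∈ IQ ES EO EC i,
      (∀ a : Fin nx, x t (j, a) = y t (j, a)) ∧
      (∀ a : Fin nu, u t (j, a) = v t (j, a)) := by
  have mem : ∀ j ∈ IQ ES EO EC i, ∀ k, (k, j) ∈ ES ∪ EO → k ∈ IQ ES EO EC i := by
    intro j hj k hk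
    simp only [IQ, Set.mem_iUnion] at hj ⊢
    obtain ⟨c, hc, hr⟩ := hj
    exact ⟨c, hc, Relation.ReflTransGen.head hk hr⟩
  have mv : ∀ (n m : ℕ) (M : Matrix (V × Fin n) (V × Fin m) ℝ) (E : Set (V × V)),
      E ⊆ ES ∪ EO →
      (∀ (j k : V) (a : Fin n) (b : Fin m), (k, j) ∉ E → M (j, a) (k, b) = 0) →
      ∀ p q : V × Fin m → ℝ, (∀ j ∈ IQ ES EO EC i, ∀ a, p (j, a) = q (j, a)) →
      ∀ j ∈ IQ ES EO EC i, ∀ a, M.mulVec p (j, a) = M.mulVec q (j, a) := by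
    intro n m M E hE hM p q hpq j hj a
    simp only [Matrix.mulVec, dotProduct]
    refine Finset.sum_congr rfl ?_
    rintro ⟨k, b⟩ -
    by_cases hk : (k, j) ∈ E
    · rw [hpq k (mem j hj k (hE hk)) b]
    · rw [hM j k a b hk, zero_mul, zero_mul]
  have hx' : ∀ t : ℕ, x (t + 1) = A.mulVec (x t) + B.mulVec (u t) := by
    intro t
    rcases Nat.eq_zero_or_pos t with rfl | ht
    · exact hx1
    · exact hx t ht
  have hy' : ∀ t : ℕ, y (t + 1) = A.mulVec (y t) + B.mulVec (v t) := by
    intro t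
    rcases Nat.eq_zero_or_pos t with rfl | ht
    · exact hy1
    · exact hy t ht
  intro t
  induction t with
  | zero => exact fun j hj => ⟨h0x j hj, h0u j hj⟩
  | succ t ih =>
    have hX : ∀ j ∈ IQ ES EO EC i, ∀ a, x (t + 1) (j, a) = y (t + 1) (j, a) := by
      intro j hj a
      rw [hx' t, hy' t, Pi.add_apply, Pi.add_apply,
        mv nx nx A ES Set.subset_union_left hA (x t) (y t) (fun j hj => (ih j hj).1) j hj a,
        mv nx nu B ES Set.subset_union_left hB (u t) (v t) (fun j hj => (ih j hj).2) j hj a]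
    refine fun j hj => ⟨hX j hj, fun a => ?_⟩
    rw [hu (t + 1) (by omega), hv (t + 1) (by omega)]
    exact mv nu nx K EO Set.subset_union_right hK _ _ hX j hj a
end

section
/- Theorem 2, deterministic trajectory form (gradient decomposition / independence): Let K, K' : Matrix (V × Fin n_u) (V × Fin n_x) ℝ both satisfy the observation sparsity pattern (K((l,a),(k,b)) = 0 and K'((l,a),(k,b)) = 0 whenever (k,l) ∉ E_O), and suppose K and K' agree on all block rows except those of agent i, i.e. K((l,a),(k,b)) = K'((l,a),(k,b)) for every l ≠ i and all a, k, b. Let A, B satisfy the state sparsity pattern (A((j,a),(k,b)) = 0 and B((j,a),(k,b)) = 0 whenever (k,j) ∉ E_S). Fix j ∈ V with i ∉ I^j_Q. Then the noiseless closed-loop trajectories x(t+1) = (A + B*K).mulVec x(t) and y(t+1) = (A + B*K').mulVec y(t), started from the same initial state x(0) = y(0), satisfy for all t ≥ 0, all l ∈ I^j_Q and all a: x(t)(l,a) = y(t)(l,a) and (K.mulVec x(t))(l,a) = (K'.mulVec y(t))(l,a). In particular, every stage cost of agent j, being a function of {(x(t)(l,·), u(t)(l,·)) : l ∈ I^j_C},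 is unchanged when only agent i's gain block K_i is changed; i.e., the local Q-function of agent j does not depend on K_i whenever j ∉ I^i_GD. -/
/-- Theorem 2 (gradient decomposition / independence), deterministic trajectory form:
if `K` and `K'` respect the observation sparsity pattern and agree on all block rows
except agent `i`'s, `A`, `B` respect the state sparsity pattern, and `i ∉ I^j_Q`, then the
two noiseless closed-loop trajectories started from the same initial state agree, on the
agents of `I^j_Q`, in both states and controls for all times; hence the local Q-function
of agent `j` does not depend on `K_i` whenever `j ∉ I^i_GD`. -/
theorem gradient_decomposition_trajectories {V : Type*} [Fintype V] [DecidableEq V]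
    (ES EO EC : Set (V × V)) (nx nu : ℕ)
    (A : Matrix (V × Fin nx) (V × Fin nx) ℝ)
    (B : Matrix (V × Fin nx) (V × Fin nu) ℝ)
    (K K' : Matrix (V × Fin nu) (V × Fin nx) ℝ)
    (hA : ∀ (j k : V) (a b : Fin nx), (k, j) ∉ ES → A (j, a) (k, b) = 0)
    (hB : ∀ (j k : V) (a : Fin nx) (b : Fin nu), (k, j) ∉ ES → B (j, a) (k, b) = 0)
    (hK : ∀ (l k : V) (a : Fin nu) (b : Fin nx), (k, l) ∉ EO → K (l, a) (k, b) = 0)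
    (hK' : ∀ (l k : V) (a : Fin nu) (b : Fin nx), (k, l) ∉ EO → K' (l, a) (k, b) = 0)
    (i : V)
    (hKK' : ∀ (l : V), l ≠ i → ∀ (a : Fin nu) (k : V) (b : Fin nx),
      K (l, a) (k, b) = K' (l, a) (k, b))
    (j : V) (hij : i ∉ IQ ES EO EC j)
    (x y : ℕ → V × Fin nx → ℝ)
    (h0 : x 0 = y 0)
    (hx : ∀ t : ℕ, x (t + 1) = (A + B * K).mulVec (x t))
    (hy : ∀ t : ℕ, y (t + 1) = (A + B * K').mulVec (y t)) :
    ∀ t : ℕ, ∀ l ∈ IQ ES EO EC j,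
      (∀ a : Fin nx, x t (l, a) = y t (l, a)) ∧
      (∀ a : Fin nu, K.mulVec (x t) (l, a) = K'.mulVec (y t) (l, a)) := by
  have hcl : ∀ k l : V, l ∈ IQ ES EO EC j → (k, l) ∈ ES ∪ EO → k ∈ IQ ES EO EC j := by
    intro k l hl hkl
    simp only [IQ, Set.mem_iUnion] at hl ⊢
    obtain ⟨c, hc, hr⟩ := hl
    exact ⟨c, hc, Relation.ReflTransGen.head hkl hr⟩
  have hu : ∀ t : ℕ, (∀ l ∈ IQ ES EO EC j, ∀ a : Fin nx, x t (l, a) = y t (l, a)) →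
      ∀ l ∈ IQ ES EO EC j, ∀ a : Fin nu,
        K.mulVec (x t) (l, a) = K'.mulVec (y t) (l, a) := by
    intro t h l hl a
    have hli : l ≠ i := fun e => hij (e ▸ hl)
    simp only [Matrix.mulVec, dotProduct]
    refine Finset.sum_congr rfl ?_
    rintro ⟨k, b⟩ -
    rw [← hKK' l hli]
    by_cases hk : (k, l) ∈ EO
    · rw [h k (hcl k l hl (Or.inr hk)) b]
    · rw [hK l k a b hk, zero_mul, zero_mul]
  have hs : ∀ t : ℕ, ∀ l ∈ IQ ES EO EC j, ∀ a : Fin nx, x t (l, a) = y t (l, a) := by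
    intro t
    induction t with
    | zero => intro l _ a; rw [h0]
    | succ t ih =>
      intro l hl a
      rw [hx, hy, Matrix.add_mulVec, Matrix.add_mulVec, ← Matrix.mulVec_mulVec,
        ← Matrix.mulVec_mulVec, Pi.add_apply, Pi.add_apply]
      congr 1
      · simp only [Matrix.mulVec, dotProduct]
        refine Finset.sum_congr rfl ?_
        rintro ⟨k, b⟩ -
        by_cases hk : (k, l) ∈ ES
        · rw [ih k (hcl k l hl (Or.inl hk)) b]
        · rw [hA l k a b hk, zero_mul, zero_mul]
      · rw [Matrix.mulVec, Matrix.mulVec, dotProduct, dotProduct]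
        refine Finset.sum_congr rfl ?_
        rintro ⟨k, b⟩ -
        by_cases hk : (k, l) ∈ ES
        · rw [hu t ih k (hcl k l hl (Or.inl hk)) b]
        · rw [hB l k a b hk, zero_mul, zero_mul]
  exact fun t l hl => ⟨hs t l hl, hu t (hs t) l hl⟩
end

section
/- Proposition 1, deterministic Bellman identity: Let A : Matrix (Fin n) (Fin n) ℝ, B : Matrix (Fin n) (Fin m) ℝ, K : Matrix (Fin m) (Fin n) ℝ, S : Matrix (Fin n) (Fin n) ℝ, R : Matrix (Fin m) (Fin m) ℝ, and suppose P : Matrix (Fin n) (Fin n) ℝ satisfies the Lyapunov equation P = (A + B*K)ᵀ * P * (A + B*K) + S + Kᵀ * R * K. Define the block matrix Q̂ : Matrix (Fin n ⊕ Fin m) (Fin n ⊕ Fin m) ℝ as Q̂ = Matrix.fromBlocks (S + Aᵀ*P*A) (Aᵀ*P*B) (Bᵀ*P*A) (R + Bᵀ*P*B). Then for all x : Fin n → ℝ and u : Fin m → ℝ, setting x' = A.mulVec x + B.mulVec u and u' = K.mulVec x', and writing z = Sum.elim x u and z' = Sum.elim x' u', the Bellman identity holds: zᵀ (Q̂.mulVec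 z) = xᵀ (S.mulVec x) + uᵀ (R.mulVec u) + z'ᵀ (Q̂.mulVec z'), where vᵀ w denotes the dot product ∑ v·w. -/
open Matrix

theorem bellman_tr_aux {k l : ℕ} (M : Matrix (Fin k) (Fin l) ℝ) (v : Fin l → ℝ)
    (w : Fin k → ℝ) : v ⬝ᵥ Mᵀ.mulVec w = M.mulVec v ⬝ᵥ w := by
  rw [Matrix.mulVec_transpose, dotProduct_comm, ← Matrix.dotProduct_mulVec, dotProduct_comm]

theorem bellman_quad_aux {n m : ℕ}
    (A : Matrix (Fin n) (Fin n) ℝ) (B : Matrix (Fin n) (Fin m) ℝ)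
    (S : Matrix (Fin n) (Fin n) ℝ)
    (R : Matrix (Fin m) (Fin m) ℝ) (P : Matrix (Fin n) (Fin n) ℝ)
    (x : Fin n → ℝ) (u : Fin m → ℝ) :
    Sum.elim x u ⬝ᵥ (Matrix.fromBlocks (S + Aᵀ * P * A) (Aᵀ * P * B) (Bᵀ * P * A)
      (R + Bᵀ * P * B)).mulVec (Sum.elim x u) = x ⬝ᵥ S.mulVec x + u ⬝ᵥ R.mulVec u +
      (A.mulVec x + B.mulVec u) ⬝ᵥ P.mulVec (A.mulVec x + B.mulVec u) := by
  rw [Matrix.fromBlocks_mulVec, sumElim_dotProduct_sumElim]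
  simp only [Sum.elim_comp_inl, Sum.elim_comp_inr, Matrix.add_mulVec, ← Matrix.mulVec_mulVec,
    dotProduct_add, add_dotProduct, Matrix.mulVec_add, bellman_tr_aux]
  ring

/-- Proposition 1, deterministic Bellman identity: if `P` solves the Lyapunov equation
`P = (A + BK)ᵀ P (A + BK) + S + Kᵀ R K` and `Q̂` is the associated block matrix, then the
quadratic form `z ↦ zᵀ Q̂ z` satisfies the Bellman identity along the deterministic
closed-loop transition. -/
theorem deterministic_bellman_identity (n m : ℕ)
    (A : Matrix (Fin n) (Fin n) ℝ) (B : Matrix (Fin n) (Fin m) ℝ)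
    (K : Matrix (Fin m) (Fin n) ℝ) (S : Matrix (Fin n) (Fin n) ℝ)
    (R : Matrix (Fin m) (Fin m) ℝ) (P : Matrix (Fin n) (Fin n) ℝ)
    (hP : P = (A + B * K)ᵀ * P * (A + B * K) + S + Kᵀ * R * K)
    (x : Fin n → ℝ) (u : Fin m → ℝ) :
    let Qhat : Matrix (Fin n ⊕ Fin m) (Fin n ⊕ Fin m) ℝ :=
      Matrix.fromBlocks (S + Aᵀ * P * A) (Aᵀ * P * B) (Bᵀ * P * A) (R + Bᵀ * P * B)
    let x' : Fin n → ℝ := A.mulVec x + B.mulVec u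
    let u' : Fin m → ℝ := K.mulVec x'
    let z : Fin n ⊕ Fin m → ℝ := Sum.elim x u
    let z' : Fin n ⊕ Fin m → ℝ := Sum.elim x' u'
    z ⬝ᵥ Qhat.mulVec z = x ⬝ᵥ S.mulVec x + u ⬝ᵥ R.mulVec u + z' ⬝ᵥ Qhat.mulVec z' := by
  intro Qhat x' u' z z'
  have h1 := bellman_quad_aux A B S R P x u
  have h2 := bellman_quad_aux A B S R P x' u'
  have h3 : x' ⬝ᵥ P.mulVec x' = x' ⬝ᵥ S.mulVec x' + u' ⬝ᵥ R.mulVec u' +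
      (A.mulVec x' + B.mulVec u') ⬝ᵥ P.mulVec (A.mulVec x' + B.mulVec u') := by
    have h4 := congrArg (fun M : Matrix (Fin n) (Fin n) ℝ => x' ⬝ᵥ M.mulVec x') hP
    have h5 : (A + B * K).mulVec x' = A.mulVec x' + B.mulVec u' := by
      rw [Matrix.add_mulVec, ← Matrix.mulVec_mulVec]
    simp only [Matrix.add_mulVec _ (Kᵀ * R * K), Matrix.add_mulVec _ S, ← Matrix.mulVec_mulVec,
      dotProduct_add x', bellman_tr_aux, h5] at h4
    change _ = _ + u' ⬝ᵥ R.mulVec u' at h4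
    linarith
  change _ = _ + x' ⬝ᵥ P.mulVec x' at h1
  change Sum.elim x u ⬝ᵥ _ = _ + Sum.elim x' u' ⬝ᵥ _
  linarith
end

section
/- Proposition 1 (linear-architecture Bellman fixed point, stochastic form): Let A : Matrix (Fin n) (Fin n) ℝ, B : Matrix (Fin n) (Fin m) ℝ, K : Matrix (Fin m) (Fin n) ℝ, S : Matrix (Fin n) (Fin n) ℝ, R : Matrix (Fin m) (Fin m) ℝ, σ² ∈ ℝ≥0, and suppose P : Matrix (Fin n) (Fin n) ℝ satisfies P = (A + B*K)ᵀ * P * (A + B*K) + S + Kᵀ * R * K. Define Q̂ = Matrix.fromBlocks (S + Aᵀ*P*A) (Aᵀ*P*B) (Bᵀ*P*A) (R + Bᵀ*P*B) and the quadratic form q(x,u) = (Sum.elim x u)ᵀ (Q̂.mulVec (Sum.elim x u)). Let G : Matrix (Fin n ⊕ Fin m) (Fin n) ℝ be the vertical stack of the identity over K, i.e. G (Sum.inl a) c = (if a = c then 1 else 0) and G (Sum.inr b) c = K b c, and set λ = σ² * (Gᵀ * Q̂ * G).trace. Let γ = Measure.pi (fun _ : Fin n => gaussianReal 0 σ²).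 Then for all x : Fin n → ℝ and u : Fin m → ℝ, setting x' = A.mulVec x + B.mulVec u: λ + q(x, u) = xᵀ (S.mulVec x) + uᵀ (R.mulVec u) + ∫ w, q(x' + w, K.mulVec (x' + w)) ∂γ. -/
open scoped NNReal
open Matrix ProbabilityTheory MeasureTheory

lemma gauss_int (n : ℕ) (v : ℝ≥0) (i : Fin n) (p : ENNReal) (hp : p ≠ ⊤) :
    MemLp (fun w : Fin n → ℝ => w i) p (Measure.pi fun _ : Fin n => gaussianReal 0 v) := by
  have := (memLp_id_gaussianReal' (μ := 0) (v := v) p hp).comp_measurePreserving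
    (measurePreserving_eval (fun _ : Fin n => gaussianReal 0 v) i)
  exact this

lemma gauss_mean (n : ℕ) (v : ℝ≥0) (i : Fin n) :
    ∫ w : Fin n → ℝ, w i ∂(Measure.pi fun _ : Fin n => gaussianReal 0 v) = 0 := by
  have := integral_comp_eval (μ := fun _ : Fin n => gaussianReal 0 v) (i := i)
    (f := fun x : ℝ => x) aestronglyMeasurable_id
  simpa using this

lemma gauss_cov (n : ℕ) (v : ℝ≥0) (i j : Fin n) :
    ∫ w : Fin n → ℝ, w i * w j ∂(Measure.pi fun _ : Fin n => gaussianReal 0 v)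
      = if i = j then (v : ℝ) else 0 := by
  split_ifs with h
  · subst h
    have := integral_comp_eval (μ := fun _ : Fin n => gaussianReal 0 v) (i := i)
      (f := fun x : ℝ => x * x) (by fun_prop)
    rw [this]
    have h2 := variance_fun_id_gaussianReal (μ := 0) (v := v)
    rw [variance_eq_integral (by fun_prop)] at h2
    simpa [pow_two] using h2
  · have hi := (iIndepFun_pi (μ := fun _ : Fin n => gaussianReal 0 v)
      (X := fun _ (x : ℝ) => x) (fun _ => aemeasurable_id)).indepFun h
    have := hi.integral_fun_mul_eq_mul_integral
      (gauss_int n v i 1 (by simp)).aestronglyMeasurable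
      (gauss_int n v j 1 (by simp)).aestronglyMeasurable
    rw [this, gauss_mean, zero_mul]

lemma gauss_quad (n : ℕ) (v : ℝ≥0) (M : Matrix (Fin n) (Fin n) ℝ) (z : Fin n → ℝ) :
    ∫ w : Fin n → ℝ, (z + w) ⬝ᵥ M.mulVec (z + w)
      ∂(Measure.pi fun _ : Fin n => gaussianReal 0 v)
      = z ⬝ᵥ M.mulVec z + v * M.trace := by
  have e1 : ∀ i j, Integrable (fun w : Fin n → ℝ => z i * M i j * w j)
      (Measure.pi fun _ : Fin n => gaussianReal 0 v) := fun i j =>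
    ((gauss_int n v j 1 (by simp)).integrable le_rfl).const_mul _
  have e2 : ∀ i j, Integrable (fun w : Fin n → ℝ => M i j * z j * w i)
      (Measure.pi fun _ : Fin n => gaussianReal 0 v) := fun i j =>
    ((gauss_int n v i 1 (by simp)).integrable le_rfl).const_mul _
  have e3 : ∀ i j, Integrable (fun w : Fin n → ℝ => M i j * (w i * w j))
      (Measure.pi fun _ : Fin n => gaussianReal 0 v) := fun i j =>
    ((gauss_int n v i 2 (by simp)).integrable_mul (gauss_int n v j 2 (by simp))).const_mul _
  have hexp : ∀ w : Fin n → ℝ, (z + w) ⬝ᵥ M.mulVec (z + w) =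
      ∑ i, ∑ j, (z i * M i j * z j + z i * M i j * w j + M i j * z j * w i
        + M i j * (w i * w j)) := by
    intro w
    simp only [dotProduct, mulVec, Finset.mul_sum, Pi.add_apply]
    refine Finset.sum_congr rfl fun i _ => Finset.sum_congr rfl fun j _ => ?_
    ring
  have e12 := fun i j => ((integrable_const (μ := (Measure.pi fun _ : Fin n => gaussianReal 0 v)) (z i * M i j * z j)).add (e1 i j))
  have e123 := fun i j => (e12 i j).add (e2 i j)
  have e : ∀ i j, Integrable (fun w : Fin n → ℝ => z i * M i j * z j + z i * M i j * w j
      + M i j * z j * w i + M i j * (w i * w j))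
      (Measure.pi fun _ : Fin n => gaussianReal 0 v) := fun i j => (e123 i j).add (e3 i j)
  simp_rw [hexp]
  rw [integral_finsetSum _ fun i _ => integrable_finsetSum _ fun j _ => e i j]
  have hterm : ∀ i j, ∫ w : Fin n → ℝ, (z i * M i j * z j + z i * M i j * w j + M i j * z j * w i
        + M i j * (w i * w j)) ∂(Measure.pi fun _ : Fin n => gaussianReal 0 v)
        = z i * M i j * z j + M i j * (if i = j then (v : ℝ) else 0) := by
    intro i j
    have a1 := integral_add (e123 i j) (e3 i j)
    have a2 := integral_add (e12 i j) (e2 i j)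
    have a3 := integral_add (integrable_const (μ := (Measure.pi fun _ : Fin n => gaussianReal 0 v)) (z i * M i j * z j)) (e1 i j)
    simp only [Pi.add_apply] at a1 a2 a3
    rw [a1, a2, a3]
    simp only [integral_const_mul, gauss_mean, gauss_cov]
    simp
  have hs : ∀ i, ∫ w : Fin n → ℝ, ∑ j, (z i * M i j * z j + z i * M i j * w j + M i j * z j * w i
        + M i j * (w i * w j)) ∂(Measure.pi fun _ : Fin n => gaussianReal 0 v)
        = ∑ j, (z i * M i j * z j + M i j * (if i = j then (v : ℝ) else 0)) := by
    intro i
    rw [integral_finsetSum _ fun j _ => e i j]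
    exact Finset.sum_congr rfl fun j _ => hterm i j
  rw [Finset.sum_congr rfl fun i _ => hs i]
  simp only [Finset.sum_add_distrib]
  congr 1
  · simp only [dotProduct, mulVec, Finset.mul_sum, mul_assoc]
  · simp [trace, Finset.mul_sum, mul_comm]

lemma dotProduct_transpose_mulVec_aux {k l : ℕ} (M : Matrix (Fin k) (Fin l) ℝ) (a : Fin l → ℝ)
    (b : Fin k → ℝ) : a ⬝ᵥ Mᵀ.mulVec b = M.mulVec a ⬝ᵥ b := by
  rw [dotProduct_mulVec, vecMul_transpose]

/-- Proposition 1 (linear-architecture Bellman fixed point, stochastic form): if `P`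
solves the Lyapunov equation, `Q̂` is the associated block matrix, `G` is the vertical
stack of the identity over `K`, and `λ = σ² · tr(Gᵀ Q̂ G)`, then the quadratic form
`q(x,u) = (x,u)ᵀ Q̂ (x,u)` satisfies the average-cost Bellman fixed-point equation with
isotropic Gaussian process noise of variance `σ²`. -/
theorem linear_architecture_bellman_fixed_point (n m : ℕ)
    (A : Matrix (Fin n) (Fin n) ℝ) (B : Matrix (Fin n) (Fin m) ℝ)
    (K : Matrix (Fin m) (Fin n) ℝ) (S : Matrix (Fin n) (Fin n) ℝ)
    (R : Matrix (Fin m) (Fin m) ℝ) (σ2 : ℝ≥0) (P : Matrix (Fin n) (Fin n) ℝ)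
    (hP : P = (A + B * K)ᵀ * P * (A + B * K) + S + Kᵀ * R * K)
    (G : Matrix (Fin n ⊕ Fin m) (Fin n) ℝ)
    (hGl : ∀ (a c : Fin n), G (Sum.inl a) c = if a = c then 1 else 0)
    (hGr : ∀ (b : Fin m) (c : Fin n), G (Sum.inr b) c = K b c)
    (x : Fin n → ℝ) (u : Fin m → ℝ) :
    let Qhat : Matrix (Fin n ⊕ Fin m) (Fin n ⊕ Fin m) ℝ :=
      Matrix.fromBlocks (S + Aᵀ * P * A) (Aᵀ * P * B) (Bᵀ * P * A) (R + Bᵀ * P * B)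
    let q : (Fin n → ℝ) → (Fin m → ℝ) → ℝ :=
      fun x u => Sum.elim x u ⬝ᵥ Qhat.mulVec (Sum.elim x u)
    let lam : ℝ := (σ2 : ℝ) * (Gᵀ * Qhat * G).trace
    let x' : Fin n → ℝ := A.mulVec x + B.mulVec u
    lam + q x u
      = x ⬝ᵥ S.mulVec x + u ⬝ᵥ R.mulVec u +
        ∫ w : Fin n → ℝ, q (x' + w) (K.mulVec (x' + w))
          ∂(Measure.pi fun _ : Fin n => gaussianReal 0 σ2) := by
  intro Qhat q lam x'
  have hG : G = fromRows 1 K := by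
    ext i j
    rcases i with i | i
    · simp [hGl, Matrix.one_apply]
    · simp [hGr]
  have hGQ : Gᵀ * Qhat * G = P := by
    rw [hG, transpose_fromRows, fromCols_mul_fromBlocks, fromCols_mul_fromRows]
    conv_rhs => rw [hP]
    simp only [transpose_one, transpose_add, transpose_mul, Matrix.mul_one, Matrix.one_mul,
      Matrix.add_mul, Matrix.mul_add, Matrix.mul_assoc]
    abel
  have hq : ∀ y, q y (K.mulVec y) = y ⬝ᵥ P.mulVec y := by
    intro y
    have : Sum.elim y (K.mulVec y) = G.mulVec y := by
      rw [hG, fromRows_mulVec, one_mulVec]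
    simp only [q, this]
    rw [← hGQ, ← mulVec_mulVec, ← mulVec_mulVec, dotProduct_mulVec y, vecMul_transpose]
  have hxu : q x u = x ⬝ᵥ S.mulVec x + u ⬝ᵥ R.mulVec u + x' ⬝ᵥ P.mulVec x' := by
    simp only [q, Qhat, x', fromBlocks_mulVec, sumElim_dotProduct_sumElim, Sum.elim_comp_inl,
      Sum.elim_comp_inr]
    simp only [add_mulVec, mulVec_add, dotProduct_add, add_dotProduct, ← mulVec_mulVec,
      dotProduct_transpose_mulVec_aux]
    ring
  simp_rw [hq]
  rw [gauss_quad, hxu]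
  simp only [lam, hGQ]
  ring
end
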